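/- arXiv:2502.20081 — 9 statements merged into one kernel-verified Lean document; each statement's English description precedes it below -/
import Mathlib

section
/- Let H be a real Hilbert space, let F : H → H be Fréchet differentiable at x ∈ H with derivative L = F'(x), and suppose F(x) = 0. If x̃ ∈ H is a weak solution, i.e. ⟨F(y), y − x̃⟩ ≥ 0 for all y ∈ H, then ⟨L z, x − x̃⟩ = 0 for every z ∈ H. -/
open scoped RealInnerProductSpace

/-- If `F : H → H` is Fréchet differentiable at `x` with derivative `L = F'(x)`,
`F(x) = 0`, and `xw` is a weak solution (i.e. `⟪F y, y - xw⟫ ≥ 0` for all `y`),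
then `⟪L z, x - xw⟫ = 0` for every `z ∈ H`. -/
theorem deriv_inner_eq_zero_of_weak_solution
    {H : Type*} [NormedAddCommGroup H] [InnerProductSpace ℝ H] [CompleteSpace H]
    (F : H → H) (x : H) (L : H →L[ℝ] H) (hF : HasFDerivAt F L x)
    (hx : F x = 0)
    (xw : H) (hweak : ∀ y : H, 0 ≤ ⟪F y, y - xw⟫) :
    ∀ z : H, ⟪L z, x - xw⟫ = 0 := by
  intro z
  have hmin : IsLocalMin (fun y => ⟪F y, y - xw⟫) x :=
    Filter.Eventually.of_forall fun y => by simpa [hx] using hweak y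
  have hderiv := hF.inner ℝ ((hasFDerivAt_id x).sub_const xw)
  have hzero := congrArg (fun A : H →L[ℝ] ℝ => A z) (hmin.hasFDerivAt_eq_zero hderiv)
  simpa [hx] using hzero
end

section
/- Let H be a real Hilbert space, let F : H → H be Fréchet differentiable at x ∈ H with derivative L = F'(x), suppose F(x) = 0, and let x̃ ∈ H satisfy ⟨F(y), y − x̃⟩ ≥ 0 for all y ∈ H. If moreover L satisfies the strict positivity property that ⟨L z, z⟩ = 0 implies z = 0 (for z ∈ H), then x = x̃. -/
open scoped RealInnerProductSpace

/-- Weak–strong uniqueness, mechanism (a): if `F` is Fréchet differentiable at a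
strong solution `x` (i.e. `F(x) = 0`) with derivative `L`, `xw` is a weak solution
(`⟪F y, y - xw⟫ ≥ 0` for all `y`), and `L` satisfies the strict positivity property
that `⟪L z, z⟫ = 0` implies `z = 0`, then `x = xw`. -/
theorem weak_strong_uniqueness_strict_positivity
    {H : Type*} [NormedAddCommGroup H] [InnerProductSpace ℝ H] [CompleteSpace H]
    (F : H → H) (x : H) (L : H →L[ℝ] H) (hF : HasFDerivAt F L x)
    (hx : F x = 0)
    (xw : H) (hweak : ∀ y : H, 0 ≤ ⟪F y, y - xw⟫)
    (hstrict : ∀ z : H, ⟪L z, z⟫ = 0 → z = 0) :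
    x = xw := by
  have hderiv := hF.inner ℝ ((hasFDerivAt_id x).sub_const xw)
  have hmin : IsLocalMin (fun y => ⟪F y, id y - xw⟫) x :=
    Filter.Eventually.of_forall fun y => by simpa [hx] using hweak y
  have hzero := DFunLike.congr_fun (hmin.hasFDerivAt_eq_zero hderiv) (x - xw)
  refine sub_eq_zero.mp (hstrict _ ?_)
  simpa [hx] using hzero
end

section
/- Let H be a real Hilbert space, let F : H → H be Fréchet differentiable at x ∈ H with derivative L = F'(x), suppose F(x) = 0, and let x̃ ∈ H satisfy ⟨F(y), y − x̃⟩ ≥ 0 for all y ∈ H. If moreover L : H → H is surjective, then x = x̃. -/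
open scoped RealInnerProductSpace

/-- Weak–strong uniqueness, mechanism (b): if `F` is Fréchet differentiable at a
strong solution `x` (i.e. `F(x) = 0`) with derivative `L`, `xw` is a weak solution
(`⟪F y, y - xw⟫ ≥ 0` for all `y`), and `L : H → H` is surjective, then `x = xw`. -/
theorem weak_strong_uniqueness_surjective
    {H : Type*} [NormedAddCommGroup H] [InnerProductSpace ℝ H] [CompleteSpace H]
    (F : H → H) (x : H) (L : H →L[ℝ] H) (hF : HasFDerivAt F L x)
    (hx : F x = 0)
    (xw : H) (hweak : ∀ y : H, 0 ≤ ⟪F y, y - xw⟫)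
    (hsurj : Function.Surjective L) :
    x = xw := by
  have hmin : IsLocalMin (fun y => ⟪F y, y - xw⟫) x :=
    Filter.Eventually.of_forall fun y => by simpa [hx] using hweak y
  have hzero := hmin.hasFDerivAt_eq_zero (hF.inner ℝ ((hasFDerivAt_id x).sub_const xw))
  obtain ⟨v, hv⟩ := hsurj (x - xw)
  have hdir := DFunLike.congr_fun hzero v
  have hinner : ⟪x - xw, x - xw⟫ = 0 := by
    simpa [hx, hv] using hdir
  exact sub_eq_zero.mp (inner_self_eq_zero.mp hinner)
end

section
/- (Boundedness of the bilinear form.) Let A : 𝕋^d → ℝ^{d×d}, b, c : 𝕋^d → ℝ^d and a : 𝕋^d → ℝ be measurable. Assume that for almost every x, A(x) is invertible, its symmetric part A_S(x) = (A(x)+A(x)ᵀ)/2 is positive definite, the symmetric part (A(x)⁻¹)_S of A(x)⁻¹ is invertible, and there is a constant τ > 0 such that ξᵀ((A(x)⁻¹)_S)⁻¹ ξ ≤ τ ξᵀA_S(x) ξ for all ξ ∈ ℝ^d and almost every x. Set κ := cᵀA⁻¹c + bᵀA⁻¹b + |a|. Let u, v : 𝕋^d → ℝ and Gu, Gv : 𝕋^d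 → ℝ^d be measurable with ‖(u,Gu)‖_X < ∞ and ‖(v,Gv)‖_X < ∞, where ‖(w,G)‖_X² = ∫_{𝕋^d}(GᵀA_S G + κ w²) dx, and assume the integrand of B[(u,Gu),(v,Gv)] := ∫_{𝕋^d} (GvᵀA Gu − v cᵀGu + u bᵀGv − a u v) dx is integrable. Then |B[(u,Gu),(v,Gv)]| ≤ (τ+3) ‖(u,Gu)‖_X ‖(v,Gv)‖_X. -/
open MeasureTheory Matrix

section PointwiseBounds

variable {n : Type*} [Fintype n]

lemma Matrix.PosSemidef.sq_dotProduct_mulVec_le {S : Matrix n n ℝ} (hS : S.PosSemidef)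
    (x y : n → ℝ) : (x ⬝ᵥ (S *ᵥ y)) ^ 2 ≤ (x ⬝ᵥ (S *ᵥ x)) * (y ⬝ᵥ (S *ᵥ y)) := by
  have hsymm : y ⬝ᵥ (S *ᵥ x) = x ⬝ᵥ (S *ᵥ y) := by
    have h : Sᵀ = S := hS.isHermitian
    rw [dotProduct_mulVec, ← mulVec_transpose, h, dotProduct_comm]
  have key : ∀ t : ℝ, 0 ≤ (y ⬝ᵥ (S *ᵥ y)) * (t * t) + (2 * (x ⬝ᵥ (S *ᵥ y))) * t
      + x ⬝ᵥ (S *ᵥ x) := by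
    intro t
    have h := hS.dotProduct_mulVec_nonneg (x + t • y)
    simp only [star_trivial, mulVec_add, mulVec_smul, dotProduct_add, add_dotProduct,
      dotProduct_smul, smul_dotProduct, smul_eq_mul, hsymm] at h
    linarith
  have h := discrim_le_zero key
  rw [discrim] at h
  linarith

lemma dotProduct_symmPart_mulVec (A : Matrix n n ℝ) (x : n → ℝ) :
    x ⬝ᵥ (((1 / 2 : ℝ) • (A + Aᵀ)) *ᵥ x) = x ⬝ᵥ (A *ᵥ x) := by
  have h : x ⬝ᵥ (Aᵀ *ᵥ x) = x ⬝ᵥ (A *ᵥ x) := by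
    rw [mulVec_transpose, dotProduct_comm, ← dotProduct_mulVec]
  rw [smul_mulVec, dotProduct_smul, add_mulVec, dotProduct_add, h, smul_eq_mul]
  ring

variable [DecidableEq n]

lemma Matrix.mul_symmPart_inv_mul_transpose {A : Matrix n n ℝ} (hA : IsUnit A.det) :
    A * ((1 / 2 : ℝ) • (A⁻¹ + (A⁻¹)ᵀ)) * Aᵀ = (1 / 2 : ℝ) • (A + Aᵀ) := by
  have h : (A⁻¹)ᵀ * Aᵀ = 1 := by rw [← transpose_mul, mul_nonsing_inv _ hA, transpose_one]
  rw [mul_smul_comm, smul_mul_assoc, mul_add, add_mul, mul_nonsing_inv _ hA, one_mul, mul_assoc,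
    h, mul_one, add_comm]

lemma posSemidef_symmPart_inv {A : Matrix n n ℝ} (hA : IsUnit A.det)
    (hS : ((1 / 2 : ℝ) • (A + Aᵀ)).PosSemidef) :
    ((1 / 2 : ℝ) • (A⁻¹ + (A⁻¹)ᵀ)).PosSemidef := by
  refine PosSemidef.of_dotProduct_mulVec_nonneg ?_ fun x => ?_
  · rw [IsHermitian, conjTranspose_eq_transpose_of_trivial, transpose_smul, transpose_add,
      transpose_transpose, add_comm]
  · have h := hS.dotProduct_mulVec_nonneg (A⁻¹ *ᵥ x)
    rw [star_trivial, dotProduct_symmPart_mulVec, mulVec_mulVec, mul_nonsing_inv _ hA,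
      one_mulVec, dotProduct_comm] at h
    rwa [star_trivial, dotProduct_symmPart_mulVec]

lemma sq_dotProduct_le_symmPart_inv {A : Matrix n n ℝ} (hA : IsUnit A.det)
    (hS : ((1 / 2 : ℝ) • (A + Aᵀ)).PosSemidef)
    (hN : IsUnit ((1 / 2 : ℝ) • (A⁻¹ + (A⁻¹)ᵀ)).det) (x g : n → ℝ) :
    (x ⬝ᵥ g) ^ 2 ≤
      (x ⬝ᵥ (A⁻¹ *ᵥ x)) * (g ⬝ᵥ (((1 / 2 : ℝ) • (A⁻¹ + (A⁻¹)ᵀ))⁻¹ *ᵥ g)) := by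
  have hz := (posSemidef_symmPart_inv hA hS).sq_dotProduct_mulVec_le x
    (((1 / 2 : ℝ) • (A⁻¹ + (A⁻¹)ᵀ))⁻¹ *ᵥ g)
  rwa [mulVec_mulVec, mul_nonsing_inv _ hN, one_mulVec, dotProduct_symmPart_mulVec,
    dotProduct_comm (_ *ᵥ _) g] at hz

lemma sq_dotProduct_mulVec_le_symmPart {A : Matrix n n ℝ} (hA : IsUnit A.det)
    (hS : ((1 / 2 : ℝ) • (A + Aᵀ)).PosSemidef)
    (hN : IsUnit ((1 / 2 : ℝ) • (A⁻¹ + (A⁻¹)ᵀ)).det) (x g : n → ℝ) :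
    (x ⬝ᵥ (A *ᵥ g)) ^ 2 ≤
      (x ⬝ᵥ (((1 / 2 : ℝ) • (A + Aᵀ)) *ᵥ x)) *
        (g ⬝ᵥ (((1 / 2 : ℝ) • (A⁻¹ + (A⁻¹)ᵀ))⁻¹ *ᵥ g)) := by
  set N := (1 / 2 : ℝ) • (A⁻¹ + (A⁻¹)ᵀ) with hNdef
  have hAT : Aᵀ * (Aᵀ)⁻¹ = 1 := mul_nonsing_inv _ (by rwa [det_transpose])
  have hy : ((1 / 2 : ℝ) • (A + Aᵀ)) *ᵥ ((Aᵀ)⁻¹ *ᵥ (N⁻¹ *ᵥ g)) = A *ᵥ g := by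
    rw [← mul_symmPart_inv_mul_transpose hA, ← hNdef, mulVec_mulVec, mul_assoc, hAT, mul_one,
      mulVec_mulVec, mul_assoc, mul_nonsing_inv _ hN, mul_one]
  have h := hS.sq_dotProduct_mulVec_le x ((Aᵀ)⁻¹ *ᵥ (N⁻¹ *ᵥ g))
  rw [hy] at h
  rwa [dotProduct_mulVec (_ *ᵥ _) A, ← mulVec_transpose A, mulVec_mulVec _ Aᵀ, hAT, one_mulVec,
    dotProduct_comm (_ *ᵥ _) g] at h

lemma abs_bilinear_integrand_le {A : Matrix n n ℝ} {b c gu gv : n → ℝ} {a τ u v : ℝ}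
    (hτ : 0 ≤ τ) (hA : IsUnit A.det) (hS : ((1 / 2 : ℝ) • (A + Aᵀ)).PosSemidef)
    (hN : IsUnit ((1 / 2 : ℝ) • (A⁻¹ + (A⁻¹)ᵀ)).det)
    (hAτ : ∀ ξ : n → ℝ, ξ ⬝ᵥ (((1 / 2 : ℝ) • (A⁻¹ + (A⁻¹)ᵀ))⁻¹ *ᵥ ξ) ≤
      τ * (ξ ⬝ᵥ (((1 / 2 : ℝ) • (A + Aᵀ)) *ᵥ ξ))) :
    |gv ⬝ᵥ (A *ᵥ gu) - v * (c ⬝ᵥ gu) + u * (b ⬝ᵥ gv) - a * u * v| ≤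
      (τ + 3) *
        (√(gu ⬝ᵥ (((1 / 2 : ℝ) • (A + Aᵀ)) *ᵥ gu) +
            (c ⬝ᵥ (A⁻¹ *ᵥ c) + b ⬝ᵥ (A⁻¹ *ᵥ b) + |a|) * u ^ 2) *
          √(gv ⬝ᵥ (((1 / 2 : ℝ) • (A + Aᵀ)) *ᵥ gv) +
            (c ⬝ᵥ (A⁻¹ *ᵥ c) + b ⬝ᵥ (A⁻¹ *ᵥ b) + |a|) * v ^ 2)) := by
  have hinv : ∀ x : n → ℝ, 0 ≤ x ⬝ᵥ (A⁻¹ *ᵥ x) := fun x => by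
    rw [← dotProduct_symmPart_mulVec]
    exact (posSemidef_symmPart_inv hA hS).dotProduct_mulVec_nonneg x
  have hpos : ∀ x : n → ℝ, 0 ≤ x ⬝ᵥ (((1 / 2 : ℝ) • (A + Aᵀ)) *ᵥ x) :=
    fun x => hS.dotProduct_mulVec_nonneg x
  have h₁ := (sq_dotProduct_mulVec_le_symmPart hA hS hN gv gu).trans
    (mul_le_mul_of_nonneg_left (hAτ gu) (hpos gv))
  have h₂ := (sq_dotProduct_le_symmPart_inv hA hS hN c gu).trans
    (mul_le_mul_of_nonneg_left (hAτ gu) (hinv c))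
  have h₃ := (sq_dotProduct_le_symmPart_inv hA hS hN b gv).trans
    (mul_le_mul_of_nonneg_left (hAτ gv) (hinv b))
  have hc := hinv c
  have hb := hinv b
  have hpu := hpos gu
  have hpv := hpos gv
  generalize gu ⬝ᵥ (((1 / 2 : ℝ) • (A + Aᵀ)) *ᵥ gu) = P at *
  generalize gv ⬝ᵥ (((1 / 2 : ℝ) • (A + Aᵀ)) *ᵥ gv) = Q at *
  generalize c ⬝ᵥ (A⁻¹ *ᵥ c) = C at *
  generalize b ⬝ᵥ (A⁻¹ *ᵥ b) = D at *
  generalize gv ⬝ᵥ (A *ᵥ gu) = X at *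
  generalize c ⬝ᵥ gu = Y at *
  generalize b ⬝ᵥ gv = Z at *
  have ha := abs_nonneg a
  set κ := C + D + |a| with hκ
  have hκ0 : 0 ≤ κ := by positivity
  set s := √τ
  set p := √P
  set q := √Q
  set k := √κ
  have hs : s ^ 2 = τ := Real.sq_sqrt hτ
  have hp : p ^ 2 = P := Real.sq_sqrt hpu
  have hq : q ^ 2 = Q := Real.sq_sqrt hpv
  have hk : k ^ 2 = κ := Real.sq_sqrt hκ0
  have hs0 : 0 ≤ s := Real.sqrt_nonneg _
  have hp0 : 0 ≤ p := Real.sqrt_nonneg _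
  have hq0 : 0 ≤ q := Real.sqrt_nonneg _
  have hk0 : 0 ≤ k := Real.sqrt_nonneg _
  have hst : s ≤ (τ + 3) / 2 := by nlinarith [sq_nonneg (s - 1)]
  have hX : |X| ≤ s * (q * p) := by
    refine abs_le_of_sq_le_sq (h₁.trans_eq ?_) (by positivity)
    rw [← hs, ← hp, ← hq]; ring
  have hY : |Y| ≤ s * (k * p) := by
    refine abs_le_of_sq_le_sq (h₂.trans ?_) (by positivity)
    calc C * (τ * P) ≤ κ * (τ * P) := by gcongr; linarith
      _ = _ := by rw [← hs, ← hp, ← hk]; ring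
  have hZ : |Z| ≤ s * (k * q) := by
    refine abs_le_of_sq_le_sq (h₃.trans ?_) (by positivity)
    calc D * (τ * Q) ≤ κ * (τ * Q) := by gcongr; linarith
      _ = _ := by rw [← hs, ← hq, ← hk]; ring
  have hak : |a| ≤ k * k := by nlinarith
  have hsqrt : ∀ r w : ℝ, r + k * |w| ≤ √2 * √(r ^ 2 + κ * w ^ 2) := fun r w => by
    rw [← Real.sqrt_mul zero_le_two]
    refine Real.le_sqrt_of_sq_le ?_
    rw [← hk, ← sq_abs w]
    nlinarith [sq_nonneg (r - k * |w|)]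
  calc |X - v * Y + u * Z - a * u * v|
      ≤ |X| + |v| * |Y| + |u| * |Z| + |a| * |u| * |v| := by
        simp only [← abs_mul]
        exact (abs_sub _ _).trans (add_le_add_left ((abs_add_le _ _).trans
          (add_le_add_left (abs_sub _ _) _)) _)
    _ ≤ s * (q * p) + |v| * (s * (k * p)) + |u| * (s * (k * q)) + k * k * |u| * |v| := by
        gcongr
    _ = s * (q * p + |v| * (k * p) + |u| * (k * q)) + 1 * (k * k * |u| * |v|) := by ring
    _ ≤ (τ + 3) / 2 * (q * p + |v| * (k * p) + |u| * (k * q)) +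
          (τ + 3) / 2 * (k * k * |u| * |v|) := by
        gcongr
        linarith
    _ = (τ + 3) / 2 * ((p + k * |u|) * (q + k * |v|)) := by ring
    _ ≤ (τ + 3) / 2 * ((√2 * √(p ^ 2 + κ * u ^ 2)) * (√2 * √(q ^ 2 + κ * v ^ 2))) := by
        gcongr <;> exact hsqrt _ _
    _ = (√2 * √2) / 2 * ((τ + 3) * (√(P + κ * u ^ 2) * √(Q + κ * v ^ 2))) := by
        rw [hp, hq]; ring
    _ = (τ + 3) * (√(P + κ * u ^ 2) * √(Q + κ * v ^ 2)) := by
        rw [Real.mul_self_sqrt zero_le_two]; ring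

end PointwiseBounds

lemma abs_integral_le_mul_sqrt_integral_mul_sqrt_integral {α : Type*} [MeasurableSpace α]
    {μ : Measure α} {f g h : α → ℝ} {K : ℝ} (hK : 0 ≤ K) (hf : Integrable f μ)
    (hg : Integrable g μ) (hf0 : 0 ≤ᵐ[μ] f) (hg0 : 0 ≤ᵐ[μ] g)
    (hle : ∀ᵐ x ∂μ, |h x| ≤ K * (√(f x) * √(g x))) :
    |∫ x, h x ∂μ| ≤ K * √(∫ x, f x ∂μ) * √(∫ x, g x ∂μ) := by
  have hL2 : ∀ {φ : α → ℝ}, Integrable φ μ → 0 ≤ᵐ[μ] φ → MemLp (fun x => √(φ x)) 2 μ := by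
    intro φ hφ hφ0
    rw [memLp_two_iff_integrable_sq (Real.continuous_sqrt.comp_aestronglyMeasurable hφ.1)]
    exact hφ.congr (hφ0.mono fun x hx => (Real.sq_sqrt hx).symm)
  have hsq : ∀ {φ : α → ℝ}, 0 ≤ᵐ[μ] φ →
      (∫ x, √(φ x) ^ (2 : ℝ) ∂μ) ^ (1 / 2 : ℝ) = √(∫ x, φ x ∂μ) := by
    intro φ hφ0
    rw [Real.sqrt_eq_rpow]
    congr 1
    exact integral_congr_ae (hφ0.mono fun x hx => by simp [Real.sq_sqrt hx])
  have hHolder := integral_mul_le_Lp_mul_Lq_of_nonneg (μ := μ) Real.HolderConjugate.two_two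
    (.of_forall fun x => Real.sqrt_nonneg (f x)) (.of_forall fun x => Real.sqrt_nonneg (g x))
    (by simpa using hL2 hf hf0) (by simpa using hL2 hg hg0)
  rw [hsq hf0, hsq hg0] at hHolder
  calc |∫ x, h x ∂μ| ≤ ∫ x, K * (√(f x) * √(g x)) ∂μ :=
        norm_integral_le_of_norm_le (f := h)
          (((hL2 hf hf0).integrable_mul (hL2 hg hg0)).const_mul K) hle
    _ = K * ∫ x, √(f x) * √(g x) ∂μ := integral_const_mul _ _
    _ ≤ K * (√(∫ x, f x ∂μ) * √(∫ x, g x ∂μ)) := mul_le_mul_of_nonneg_left hHolder hK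
    _ = _ := (mul_assoc _ _ _).symm

/-- Boundedness of the bilinear form `B[(u,Gu),(v,Gv)] = ∫ (GvᵀA Gu − v c·Gu +
u b·Gv − a u v)`: under the structural assumptions on `A` (a.e. invertible,
positive definite symmetric part `A_S`, invertible `(A⁻¹)_S`, and
`ξᵀ((A⁻¹)_S)⁻¹ξ ≤ τ ξᵀA_Sξ`), one has
`|B| ≤ (τ+3) ‖(u,Gu)‖_X ‖(v,Gv)‖_X`, where
`‖(w,G)‖_X² = ∫ (GᵀA_S G + κ w²)` and `κ = cᵀA⁻¹c + bᵀA⁻¹b + |a|`. -/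
theorem bilinear_form_bounded
    (d : ℕ) (hd : 1 ≤ d)
    (A : (Fin d → UnitAddCircle) → Matrix (Fin d) (Fin d) ℝ)
    (b c : (Fin d → UnitAddCircle) → (Fin d → ℝ))
    (a : (Fin d → UnitAddCircle) → ℝ) (τ : ℝ) (hτ : 0 < τ)
    (hAmeas : ∀ i j, Measurable fun x => A x i j)
    (hbmeas : Measurable b) (hcmeas : Measurable c) (hameas : Measurable a)
    (AS : (Fin d → UnitAddCircle) → Matrix (Fin d) (Fin d) ℝ)
    (hAS : AS = fun x => (1 / 2 : ℝ) • (A x + (A x)ᵀ))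
    (AinvS : (Fin d → UnitAddCircle) → Matrix (Fin d) (Fin d) ℝ)
    (hAinvS : AinvS = fun x => (1 / 2 : ℝ) • ((A x)⁻¹ + ((A x)⁻¹)ᵀ))
    (hAinv : ∀ᵐ x, IsUnit (A x).det)
    (hASpos : ∀ᵐ x, (AS x).PosDef)
    (hAinvSinv : ∀ᵐ x, IsUnit (AinvS x).det)
    (hAτ : ∀ᵐ x, ∀ ξ : Fin d → ℝ,
      ξ ⬝ᵥ ((AinvS x)⁻¹ *ᵥ ξ) ≤ τ * (ξ ⬝ᵥ (AS x *ᵥ ξ)))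
    (κ : (Fin d → UnitAddCircle) → ℝ)
    (hκ : κ = fun x =>
      c x ⬝ᵥ ((A x)⁻¹ *ᵥ c x) + b x ⬝ᵥ ((A x)⁻¹ *ᵥ b x) + |a x|)
    (u v : (Fin d → UnitAddCircle) → ℝ)
    (Gu Gv : (Fin d → UnitAddCircle) → (Fin d → ℝ))
    (humeas : Measurable u) (hvmeas : Measurable v)
    (hGumeas : Measurable Gu) (hGvmeas : Measurable Gv)
    (hXu : Integrable (fun x => Gu x ⬝ᵥ (AS x *ᵥ Gu x) + κ x * (u x) ^ 2))
    (hXv : Integrable (fun x => Gv x ⬝ᵥ (AS x *ᵥ Gv x) + κ x * (v x) ^ 2))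
    (hBint : Integrable (fun x =>
      Gv x ⬝ᵥ (A x *ᵥ Gu x) - v x * (c x ⬝ᵥ Gu x) + u x * (b x ⬝ᵥ Gv x)
        - a x * u x * v x)) :
    |∫ x, (Gv x ⬝ᵥ (A x *ᵥ Gu x) - v x * (c x ⬝ᵥ Gu x) + u x * (b x ⬝ᵥ Gv x)
        - a x * u x * v x)| ≤
      (τ + 3) *
        Real.sqrt (∫ x, (Gu x ⬝ᵥ (AS x *ᵥ Gu x) + κ x * (u x) ^ 2)) *
        Real.sqrt (∫ x, (Gv x ⬝ᵥ (AS x *ᵥ Gv x) + κ x * (v x) ^ 2)) := by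
  subst hAS hAinvS hκ
  have hnonneg : ∀ (w : (Fin d → UnitAddCircle) → ℝ) (G : (Fin d → UnitAddCircle) → (Fin d → ℝ)),
      ∀ᵐ x, 0 ≤ G x ⬝ᵥ (((1 / 2 : ℝ) • (A x + (A x)ᵀ)) *ᵥ G x) +
        (c x ⬝ᵥ ((A x)⁻¹ *ᵥ c x) + b x ⬝ᵥ ((A x)⁻¹ *ᵥ b x) + |a x|) * (w x) ^ 2 := by
    intro w G
    filter_upwards [hAinv, hASpos] with x hdet hpos
    have hinv : ∀ y : Fin d → ℝ, 0 ≤ y ⬝ᵥ ((A x)⁻¹ *ᵥ y) := fun y => by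
      rw [← dotProduct_symmPart_mulVec]
      exact (posSemidef_symmPart_inv hdet hpos.posSemidef).dotProduct_mulVec_nonneg y
    have hG : 0 ≤ G x ⬝ᵥ (((1 / 2 : ℝ) • (A x + (A x)ᵀ)) *ᵥ G x) :=
      hpos.posSemidef.dotProduct_mulVec_nonneg (G x)
    have hc := hinv (c x)
    have hb := hinv (b x)
    positivity
  refine abs_integral_le_mul_sqrt_integral_mul_sqrt_integral (by positivity) hXu hXv
    (hnonneg u Gu) (hnonneg v Gv) ?_
  filter_upwards [hAinv, hASpos, hAinvSinv, hAτ] with x hdet hpos hinv hbound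
  exact abs_bilinear_integrand_le hτ.le hdet hpos.posSemidef hinv hbound
end

section
/- (Triviality of the kernel under a coercivity condition.) Let A : 𝕋^d → ℝ^{d×d}, b, c : 𝕋^d → ℝ^d and a : 𝕋^d → ℝ be measurable, with A(x) symmetric and positive definite for almost every x. Suppose there exist ε > 1/2 and θ > 0 such that ε (cᵀA⁻¹c + bᵀA⁻¹b) + a ≤ −θ almost everywhere on 𝕋^d. Let u : 𝕋^d → ℝ and G : 𝕋^d → ℝ^d be measurable with GᵀA G, u (c+b)·G and a u² integrable, and suppose ∫_{𝕋^d} (GᵀA G + u (c+b)·G − a u²) dx = 0. Then u = 0 almost everywhere on 𝕋^d. -/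
open MeasureTheory Matrix

/-- Completing the square for a weighted linear term: a lower bound on half of the energy
`GᵀAG` plus `t c·G`. -/
lemma half_energy_add_linear_nonneg {n : Type*} [Fintype n] [DecidableEq n]
    {A : Matrix n n ℝ} (hA : A.PosDef) (c G : n → ℝ) (t : ℝ) :
    0 ≤ G ⬝ᵥ (A *ᵥ G) / 2 + t * (c ⬝ᵥ G) + t ^ 2 / 2 * (c ⬝ᵥ (A⁻¹ *ᵥ c)) := by
  have hsymm : Aᵀ = A := by simpa using hA.isHermitian.eq
  have hdet : IsUnit A.det := hA.det_pos.ne'.isUnit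
  have hc : A *ᵥ (A⁻¹ *ᵥ c) = c := by
    rw [mulVec_mulVec, mul_nonsing_inv A hdet, one_mulVec]
  have hcross : (A⁻¹ *ᵥ c) ⬝ᵥ (A *ᵥ G) = c ⬝ᵥ G := by
    rw [dotProduct_mulVec, ← mulVec_transpose, hsymm, hc]
  have hsq := hA.posSemidef.dotProduct_mulVec_nonneg (G + t • (A⁻¹ *ᵥ c))
  simp only [star_trivial, mulVec_add, mulVec_smul, hc, dotProduct_add, add_dotProduct,
    smul_dotProduct, dotProduct_smul, smul_eq_mul, hcross] at hsq
  rw [dotProduct_comm G c, dotProduct_comm (A⁻¹ *ᵥ c) c] at hsq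
  linarith

/-- Pointwise coercivity of the quadratic form `GᵀAG + t(c+b)·G − αt²`. -/
lemma mul_sq_le_quadratic_form {n : Type*} [Fintype n] [DecidableEq n]
    {A : Matrix n n ℝ} (hA : A.PosDef) {b c : n → ℝ} {α ε θ : ℝ} (hε : 1 / 2 ≤ ε)
    (h : ε * (c ⬝ᵥ (A⁻¹ *ᵥ c) + b ⬝ᵥ (A⁻¹ *ᵥ b)) + α ≤ -θ) (G : n → ℝ) (t : ℝ) :
    θ * t ^ 2 ≤ G ⬝ᵥ (A *ᵥ G) + t * ((c + b) ⬝ᵥ G) - α * t ^ 2 := by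
  have hc := half_energy_add_linear_nonneg hA c G t
  have hb := half_energy_add_linear_nonneg hA b G t
  have hcc : 0 ≤ c ⬝ᵥ (A⁻¹ *ᵥ c) := by
    simpa using hA.inv.posSemidef.dotProduct_mulVec_nonneg c
  have hbb : 0 ≤ b ⬝ᵥ (A⁻¹ *ᵥ b) := by
    simpa using hA.inv.posSemidef.dotProduct_mulVec_nonneg b
  have hcoerc := mul_le_mul_of_nonneg_right h (sq_nonneg t)
  have hgap := mul_nonneg (mul_nonneg (sub_nonneg.2 hε) (add_nonneg hcc hbb)) (sq_nonneg t)
  rw [add_dotProduct]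
  linarith

/-- Triviality of the kernel under the coercivity condition
`ε(cᵀA⁻¹c + bᵀA⁻¹b) + a ≤ −θ` (with `ε > 1/2`, `θ > 0`): if the pair `(u, G)`
satisfies `∫ (GᵀAG + u(c+b)·G − a u²) = 0`, then `u = 0` a.e. -/
theorem kernel_trivial_of_coercivity
    (d : ℕ) (hd : 1 ≤ d)
    (A : (Fin d → UnitAddCircle) → Matrix (Fin d) (Fin d) ℝ)
    (b c : (Fin d → UnitAddCircle) → (Fin d → ℝ))
    (a : (Fin d → UnitAddCircle) → ℝ)
    (hAmeas : ∀ i j, Measurable fun x => A x i j)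
    (hbmeas : Measurable b) (hcmeas : Measurable c) (hameas : Measurable a)
    (hAsym : ∀ᵐ x, (A x).IsSymm) (hApos : ∀ᵐ x, (A x).PosDef)
    (ε θ : ℝ) (hε : 1 / 2 < ε) (hθ : 0 < θ)
    (hcoerc : ∀ᵐ x,
      ε * (c x ⬝ᵥ ((A x)⁻¹ *ᵥ c x) + b x ⬝ᵥ ((A x)⁻¹ *ᵥ b x)) + a x ≤ -θ)
    (u : (Fin d → UnitAddCircle) → ℝ)
    (G : (Fin d → UnitAddCircle) → (Fin d → ℝ))
    (humeas : Measurable u) (hGmeas : Measurable G)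
    (h1 : Integrable (fun x => G x ⬝ᵥ (A x *ᵥ G x)))
    (h2 : Integrable (fun x => u x * ((c x + b x) ⬝ᵥ G x)))
    (h3 : Integrable (fun x => a x * (u x) ^ 2))
    (hzero : ∫ x, (G x ⬝ᵥ (A x *ᵥ G x) + u x * ((c x + b x) ⬝ᵥ G x)
      - a x * (u x) ^ 2) = 0) :
    ∀ᵐ x, u x = 0 := by
  have hbound : ∀ᵐ x, θ * u x ^ 2 ≤
      G x ⬝ᵥ (A x *ᵥ G x) + u x * ((c x + b x) ⬝ᵥ G x) - a x * (u x) ^ 2 := by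
    filter_upwards [hApos, hcoerc] with x hA hx
    exact mul_sq_le_quadratic_form hA hε.le hx (G x) (u x)
  have hnonneg : 0 ≤ᵐ[volume] fun x =>
      G x ⬝ᵥ (A x *ᵥ G x) + u x * ((c x + b x) ⬝ᵥ G x) - a x * (u x) ^ 2 := by
    filter_upwards [hbound] with x hx
    exact (mul_nonneg hθ.le (sq_nonneg _)).trans hx
  have hae := (integral_eq_zero_iff_of_nonneg_ae hnonneg ((h1.add h2).sub h3)).1 hzero
  filter_upwards [hbound, hae] with x hx h0
  rw [h0] at hx
  exact pow_eq_zero_iff two_ne_zero |>.1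
    (le_antisymm (nonpos_of_mul_nonpos_right hx hθ) (sq_nonneg _))
end

section
/- Let d ≥ 1, let γ ≥ α > 0, m > 0 and p ∈ ℝ^d, and define the d×d real matrix A = m^{1−α} (1+|p|²)^{γ/2−2} [ (1+|p|²) I + (γ/α − 2) p⊗p ]. Then A is symmetric and, for every ξ ∈ ℝ^d, ξᵀA ξ ≥ m^{1−α} (1+|p|²)^{γ/2−2} |ξ|². -/
open Matrix

/-- For the congestion Hamiltonian, the matrix
`A = m^{1−α}(1+|p|²)^{γ/2−2}[(1+|p|²)I + (γ/α−2) p⊗p]` is symmetric and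
satisfies `ξᵀAξ ≥ m^{1−α}(1+|p|²)^{γ/2−2}|ξ|²` when `γ ≥ α > 0` and `m > 0`. -/
theorem congestion_matrix_coercive
    (d : ℕ) (hd : 1 ≤ d) (γ α m : ℝ) (hαγ : α ≤ γ) (hα : 0 < α) (hm : 0 < m)
    (p : Fin d → ℝ)
    (A : Matrix (Fin d) (Fin d) ℝ)
    (hA : A = (m ^ (1 - α) * (1 + p ⬝ᵥ p) ^ (γ / 2 - 2)) •
      ((1 + p ⬝ᵥ p) • (1 : Matrix (Fin d) (Fin d) ℝ) +
        (γ / α - 2) • vecMulVec p p)) :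
    A.IsSymm ∧ ∀ ξ : Fin d → ℝ,
      m ^ (1 - α) * (1 + p ⬝ᵥ p) ^ (γ / 2 - 2) * (ξ ⬝ᵥ ξ) ≤ ξ ⬝ᵥ (A *ᵥ ξ) := by
  subst hA
  refine ⟨?_, fun ξ => ?_⟩
  · simp [IsSymm, transpose_vecMulVec]
  have hp : 0 ≤ p ⬝ᵥ p := Finset.sum_nonneg fun i _ => mul_self_nonneg (p i)
  have hc : 0 ≤ m ^ (1 - α) * (1 + p ⬝ᵥ p) ^ (γ / 2 - 2) := by positivity
  have hcs : (p ⬝ᵥ ξ) ^ 2 ≤ (p ⬝ᵥ p) * (ξ ⬝ᵥ ξ) := by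
    simpa only [dotProduct, sq] using Finset.sum_mul_sq_le_sq_mul_sq Finset.univ p ξ
  have hk : 0 ≤ γ / α - 1 := sub_nonneg.2 ((one_le_div hα).2 hαγ)
  have hform : ξ ⬝ᵥ (((1 + p ⬝ᵥ p) • (1 : Matrix (Fin d) (Fin d) ℝ) +
      (γ / α - 2) • vecMulVec p p) *ᵥ ξ) =
      (1 + p ⬝ᵥ p) * (ξ ⬝ᵥ ξ) + (γ / α - 2) * (p ⬝ᵥ ξ) ^ 2 := by
    simp only [add_mulVec, smul_mulVec, one_mulVec, vecMulVec_mulVec, dotProduct_add,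
      dotProduct_smul, smul_eq_mul, op_smul_eq_smul, dotProduct_comm ξ p]
    ring
  rw [smul_mulVec, dotProduct_smul, smul_eq_mul, hform]
  refine mul_le_mul_of_nonneg_left ?_ hc
  linarith [mul_nonneg hk (sq_nonneg (p ⬝ᵥ ξ))]
end

section
/- Let d ≥ 1, γ > 0, α > 0, m > 0, p, ξ ∈ ℝ^d and ξ' ∈ ℝ. Then m^{1−α}(1+|p|²)^{γ/2−2}[ (1+|p|²)|ξ|² + (γ/α − 2)(p·ξ)² ] + γ m (1+|p|²)^{−1}(p·ξ)ξ' + (γ/α) m^{α+1}(1+|p|²)^{−γ/2}(ξ')² ≥ m^{1−α}(1+|p|²)^{γ/2−2}[ |ξ|² + |p|²|ξ|² − (p·ξ)² + (γ/α − 1 − αγ/4)(p·ξ)² ]. -/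
open Matrix

/-- A binary quadratic form `γ (α A / 4 · q² + c q x + B / α · x²)` with vanishing discriminant
`A B = c²` and positive leading coefficient is nonnegative. -/
lemma degenerate_form_nonneg {γ α A B c : ℝ} (hγ : 0 < γ) (hα : 0 < α) (hA : 0 < A)
    (h : A * B = c ^ 2) (q x : ℝ) :
    0 ≤ A * (α * γ / 4) * q ^ 2 + γ * c * q * x + γ / α * B * x ^ 2 := by
  have hB : B = c ^ 2 / A := by rw [← h]; field_simp
  have key : A * (α * γ / 4) * q ^ 2 + γ * c * q * x + γ / α * B * x ^ 2 =
      γ / (α * A) * (α * A * q / 2 + c * x) ^ 2 := by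
    rw [hB]; field_simp; ring
  rw [key]
  positivity

/-- Cauchy-inequality estimate for the quadratic form of the block matrix
arising from the congestion Hamiltonian `H(x,p,m) = (1+|p|²)^{γ/2}/(γ m^α)`:
`m^{1−α}(1+|p|²)^{γ/2−2}[(1+|p|²)|ξ|² + (γ/α−2)(p·ξ)²]
 + γ m (1+|p|²)^{−1}(p·ξ)ξ' + (γ/α) m^{α+1}(1+|p|²)^{−γ/2}(ξ')²
 ≥ m^{1−α}(1+|p|²)^{γ/2−2}[|ξ|² + |p|²|ξ|² − (p·ξ)² + (γ/α−1−αγ/4)(p·ξ)²]`. -/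
theorem congestion_block_form_lower_bound
    (d : ℕ) (hd : 1 ≤ d) (γ α m : ℝ) (hγ : 0 < γ) (hα : 0 < α) (hm : 0 < m)
    (p ξ : Fin d → ℝ) (ξ' : ℝ) :
    m ^ (1 - α) * (1 + p ⬝ᵥ p) ^ (γ / 2 - 2) *
        (ξ ⬝ᵥ ξ + (p ⬝ᵥ p) * (ξ ⬝ᵥ ξ) - (p ⬝ᵥ ξ) ^ 2 +
          (γ / α - 1 - α * γ / 4) * (p ⬝ᵥ ξ) ^ 2) ≤
      m ^ (1 - α) * (1 + p ⬝ᵥ p) ^ (γ / 2 - 2) *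
          ((1 + p ⬝ᵥ p) * (ξ ⬝ᵥ ξ) + (γ / α - 2) * (p ⬝ᵥ ξ) ^ 2) +
        γ * m * (1 + p ⬝ᵥ p)⁻¹ * (p ⬝ᵥ ξ) * ξ' +
        (γ / α) * m ^ (α + 1) * (1 + p ⬝ᵥ p) ^ (-(γ / 2)) * ξ' ^ 2 := by
  have hS : 0 < 1 + p ⬝ᵥ p :=
    add_pos_of_pos_of_nonneg one_pos (Finset.sum_nonneg fun i _ => mul_self_nonneg (p i))
  generalize p ⬝ᵥ p = P at hS ⊢
  have hA : 0 < m ^ (1 - α) * (1 + P) ^ (γ / 2 - 2) := by positivity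
  have hAB : m ^ (1 - α) * (1 + P) ^ (γ / 2 - 2) * (m ^ (α + 1) * (1 + P) ^ (-(γ / 2))) =
      (m * (1 + P)⁻¹) ^ 2 := by
    rw [mul_mul_mul_comm, ← Real.rpow_add hm, ← Real.rpow_add hS,
      show 1 - α + (α + 1) = (2 : ℝ) by ring, show γ / 2 - 2 + -(γ / 2) = -(2 : ℝ) by ring,
      Real.rpow_neg hS.le, Real.rpow_two, Real.rpow_two, mul_pow, inv_pow]
  linear_combination degenerate_form_nonneg hγ hα hA hAB (p ⬝ᵥ ξ) ξ'
end

section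
/- Let d ≥ 1, γ ≥ 1, m > 0 and p ∈ ℝ^d, and suppose 0 < α ≤ (2/γ)(−1 + √(1+γ²)). Then the quadratic form Q(ξ, ξ') = m^{1−α}(1+|p|²)^{γ/2−2}[ (1+|p|²)|ξ|² + (γ/α − 2)(p·ξ)² ] + γ m (1+|p|²)^{−1}(p·ξ)ξ' + (γ/α) m^{α+1}(1+|p|²)^{−γ/2}(ξ')² satisfies Q(ξ, ξ') > 0 for every (ξ, ξ') ∈ ℝ^d × ℝ with (ξ, ξ') ≠ (0, 0). -/
open Matrix

/-- Under the bound `α ≤ (2/γ)(−1+√(1+γ²))`, the Schur complement coefficient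
`γ/α − 1 − αγ/4` is nonnegative. -/
theorem congestion_coeff_nonneg {γ α : ℝ} (hγ : 0 < γ) (hα0 : 0 < α)
    (hα : α ≤ (2 / γ) * (-1 + Real.sqrt (1 + γ ^ 2))) :
    0 ≤ γ / α - 1 - α * γ / 4 := by
  have hle : α * γ / 2 + 1 ≤ Real.sqrt (1 + γ ^ 2) := by
    have h := mul_le_mul_of_nonneg_right hα hγ.le
    have e : 2 / γ * (-1 + Real.sqrt (1 + γ ^ 2)) * γ = 2 * (-1 + Real.sqrt (1 + γ ^ 2)) := by
      field_simp
    linarith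
  have hsq : (α * γ / 2 + 1) ^ 2 ≤ 1 + γ ^ 2 :=
    (Real.le_sqrt' (by positivity)).1 hle
  have hquad : 0 ≤ γ - α - α ^ 2 * γ / 4 := by
    refine nonneg_of_mul_nonneg_right (a := γ) ?_ hγ
    nlinarith
  have e : γ / α - 1 - α * γ / 4 = (γ - α - α ^ 2 * γ / 4) / α := by
    field_simp
  rw [e]
  exact div_nonneg hquad hα0.le

/-- The Cauchy–Schwarz inequality for the dot product of real vectors. -/
theorem dotProduct_sq_le_mul {ι : Type*} [Fintype ι] (v w : ι → ℝ) :
    (v ⬝ᵥ w) ^ 2 ≤ (v ⬝ᵥ v) * (w ⬝ᵥ w) := by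
  simpa only [dotProduct, sq] using Finset.sum_mul_sq_le_sq_mul_sq Finset.univ v w

/-- The scalar core of the block form: positivity by completing the square in the last variable. -/
theorem block_form_pos {K L c γ α P u X y : ℝ} (hK : 0 < K) (hc : K * L = c ^ 2) (hc0 : 0 < c)
    (hγ : 0 < γ) (hα : 0 < α) (hcoeff : 0 ≤ γ / α - 1 - α * γ / 4)
    (hu : u ^ 2 ≤ P * X) (hX : 0 ≤ X) (hXy : 0 < X ∨ y ≠ 0) :
    0 < K * ((1 + P) * X + (γ / α - 2) * u ^ 2) + γ * c * u * y + γ / α * L * y ^ 2 := by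
  have hL : L = c ^ 2 / K := by
    field_simp
    linarith
  have key : K * ((1 + P) * X + (γ / α - 2) * u ^ 2) + γ * c * u * y + γ / α * L * y ^ 2 =
      K * X + K * (P * X - u ^ 2) + K * ((γ / α - 1 - α * γ / 4) * u ^ 2) +
        γ / α / K * (c * y + α / 2 * K * u) ^ 2 := by
    rw [hL]
    field_simp
    ring
  have h₁ : 0 ≤ K * (P * X - u ^ 2) := mul_nonneg hK.le (sub_nonneg.2 hu)
  have h₂ : 0 ≤ K * ((γ / α - 1 - α * γ / 4) * u ^ 2) :=
    mul_nonneg hK.le (mul_nonneg hcoeff (sq_nonneg u))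
  have h₃ : 0 ≤ γ / α / K * (c * y + α / 2 * K * u) ^ 2 := by positivity
  rw [key]
  rcases hX.eq_or_lt with rfl | hX'
  · have hy : y ≠ 0 := hXy.resolve_left (lt_irrefl 0)
    have hu0 : u = 0 := by
      rw [mul_zero] at hu
      exact pow_eq_zero_iff two_ne_zero |>.1 (le_antisymm hu (sq_nonneg u))
    have : 0 < γ / α / K * (c * y + α / 2 * K * u) ^ 2 := by
      rw [hu0, mul_zero, add_zero]
      positivity
    linarith
  · have := mul_pos hK hX'
    linarith

/-- Positive definiteness of the block quadratic form for the congestion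
Hamiltonian: if `γ ≥ 1`, `m > 0` and `0 < α ≤ (2/γ)(−1+√(1+γ²))`, then
`Q(ξ,ξ') = m^{1−α}(1+|p|²)^{γ/2−2}[(1+|p|²)|ξ|² + (γ/α−2)(p·ξ)²]
 + γ m (1+|p|²)^{−1}(p·ξ)ξ' + (γ/α) m^{α+1}(1+|p|²)^{−γ/2}(ξ')² > 0`
for every `(ξ,ξ') ≠ (0,0)`. -/
theorem congestion_block_form_posdef
    (d : ℕ) (hd : 1 ≤ d) (γ α m : ℝ) (hγ : 1 ≤ γ) (hm : 0 < m)
    (hα0 : 0 < α) (hα : α ≤ (2 / γ) * (-1 + Real.sqrt (1 + γ ^ 2)))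
    (p : Fin d → ℝ) :
    ∀ (ξ : Fin d → ℝ) (ξ' : ℝ), (ξ ≠ 0 ∨ ξ' ≠ 0) →
      0 < m ^ (1 - α) * (1 + p ⬝ᵥ p) ^ (γ / 2 - 2) *
            ((1 + p ⬝ᵥ p) * (ξ ⬝ᵥ ξ) + (γ / α - 2) * (p ⬝ᵥ ξ) ^ 2) +
          γ * m * (1 + p ⬝ᵥ p)⁻¹ * (p ⬝ᵥ ξ) * ξ' +
          (γ / α) * m ^ (α + 1) * (1 + p ⬝ᵥ p) ^ (-(γ / 2)) * ξ' ^ 2 := by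
  intro ξ ξ' hne
  have hp : 0 ≤ p ⬝ᵥ p := Finset.sum_nonneg fun i _ => mul_self_nonneg (p i)
  have hs : 0 < 1 + p ⬝ᵥ p := by linarith
  have hX : 0 ≤ ξ ⬝ᵥ ξ := Finset.sum_nonneg fun i _ => mul_self_nonneg (ξ i)
  have hγ0 : 0 < γ := by linarith
  have hc : m ^ (1 - α) * (1 + p ⬝ᵥ p) ^ (γ / 2 - 2) *
      (m ^ (α + 1) * (1 + p ⬝ᵥ p) ^ (-(γ / 2))) = (m * (1 + p ⬝ᵥ p)⁻¹) ^ 2 := by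
    rw [mul_mul_mul_comm, ← Real.rpow_add hm, ← Real.rpow_add hs,
      show 1 - α + (α + 1) = (2 : ℕ) by push_cast; ring,
      show γ / 2 - 2 + -(γ / 2) = -(2 : ℕ) by push_cast; ring,
      Real.rpow_neg hs.le, Real.rpow_natCast, Real.rpow_natCast, mul_pow, inv_pow]
  have h := block_form_pos (y := ξ') (by positivity) hc (by positivity) hγ0 hα0
    (congestion_coeff_nonneg hγ0 hα0 hα) (dotProduct_sq_le_mul p ξ) hX
    (hne.imp_left fun h => hX.lt_of_ne' (mt dotProduct_self_eq_zero.1 h))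
  simpa only [mul_assoc] using h
end

section
/- Let d ≥ 1, γ ≥ 1, m > 0, s > 0 and p ∈ ℝ^d, and define the d×d real matrix A = m (1+|p|²)^{γ/2−2} [ (1+|p|²) I + (γ − 2) p⊗p ] + s^{−1} (1+|p|²)^{γ−2} p⊗p. Then A is symmetric and positive definite; more precisely, for every ξ ∈ ℝ^d, ξᵀA ξ ≥ m (1+|p|²)^{γ/2−2} |ξ|². -/
open Matrix

/-- The Cauchy-Schwarz inequality for the real dot product. -/
lemma dotProduct_sq_le {ι : Type*} [Fintype ι] (u v : ι → ℝ) :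
    (u ⬝ᵥ v) ^ 2 ≤ (u ⬝ᵥ u) * (v ⬝ᵥ v) := by
  simpa only [dotProduct, sq] using Finset.sum_mul_sq_le_sq_mul_sq Finset.univ u v

/-- The quadratic form of `p ⊗ q` is the product of two linear forms. -/
lemma dotProduct_vecMulVec_mulVec {ι R : Type*} [Fintype ι] [CommSemiring R] (p q u v : ι → R) :
    u ⬝ᵥ (vecMulVec p q *ᵥ v) = (u ⬝ᵥ p) * (q ⬝ᵥ v) := by
  rw [vecMulVec_mulVec, op_smul_eq_smul, dotProduct_smul, smul_eq_mul, mul_comm]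

/-- For the power Hamiltonian `H(x,p,m) = (1+|p|²)^{γ/2}/γ − g(m)` with
`s = g'(m) > 0`, the matrix
`A = m(1+|p|²)^{γ/2−2}[(1+|p|²)I + (γ−2) p⊗p] + s⁻¹(1+|p|²)^{γ−2} p⊗p`
is symmetric and positive definite, with `ξᵀAξ ≥ m(1+|p|²)^{γ/2−2}|ξ|²`. -/
theorem power_matrix_coercive
    (d : ℕ) (hd : 1 ≤ d) (γ m s : ℝ) (hγ : 1 ≤ γ) (hm : 0 < m) (hs : 0 < s)
    (p : Fin d → ℝ)
    (A : Matrix (Fin d) (Fin d) ℝ)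
    (hA : A = (m * (1 + p ⬝ᵥ p) ^ (γ / 2 - 2)) •
        ((1 + p ⬝ᵥ p) • (1 : Matrix (Fin d) (Fin d) ℝ) +
          (γ - 2) • vecMulVec p p) +
      (s⁻¹ * (1 + p ⬝ᵥ p) ^ (γ - 2)) • vecMulVec p p) :
    A.IsSymm ∧ A.PosDef ∧ ∀ ξ : Fin d → ℝ,
      m * (1 + p ⬝ᵥ p) ^ (γ / 2 - 2) * (ξ ⬝ᵥ ξ) ≤ ξ ⬝ᵥ (A *ᵥ ξ) := by
  have hbase : 0 < 1 + p ⬝ᵥ p := by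
    have : 0 ≤ p ⬝ᵥ p := by simpa only [star_trivial] using dotProduct_star_self_nonneg p
    positivity
  have hcoeff : 0 < m * (1 + p ⬝ᵥ p) ^ (γ / 2 - 2) := by positivity
  have hsymm : A.IsSymm := by
    rw [hA]
    simp [IsSymm, transpose_vecMulVec]
  have hquad (ξ : Fin d → ℝ) : m * (1 + p ⬝ᵥ p) ^ (γ / 2 - 2) * (ξ ⬝ᵥ ξ) ≤ ξ ⬝ᵥ (A *ᵥ ξ) := by
    have hform : ξ ⬝ᵥ (A *ᵥ ξ) =
        m * (1 + p ⬝ᵥ p) ^ (γ / 2 - 2) *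
          ((1 + p ⬝ᵥ p) * (ξ ⬝ᵥ ξ) + (γ - 2) * (p ⬝ᵥ ξ) ^ 2) +
        s⁻¹ * (1 + p ⬝ᵥ p) ^ (γ - 2) * (p ⬝ᵥ ξ) ^ 2 := by
      rw [hA]
      simp only [add_mulVec, smul_mulVec, one_mulVec, dotProduct_add, dotProduct_smul,
        dotProduct_vecMulVec_mulVec, dotProduct_comm ξ p, smul_eq_mul]
      ring
    rw [hform]
    have hrank : 0 ≤ s⁻¹ * (1 + p ⬝ᵥ p) ^ (γ - 2) * (p ⬝ᵥ ξ) ^ 2 := by positivity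
    have hbracket : ξ ⬝ᵥ ξ ≤ (1 + p ⬝ᵥ p) * (ξ ⬝ᵥ ξ) + (γ - 2) * (p ⬝ᵥ ξ) ^ 2 := by
      nlinarith [dotProduct_sq_le p ξ, mul_nonneg (sub_nonneg.2 hγ) (sq_nonneg (p ⬝ᵥ ξ))]
    linarith [mul_le_mul_of_nonneg_left hbracket hcoeff.le]
  refine ⟨hsymm, ?_, hquad⟩
  refine PosDef.of_dotProduct_mulVec_pos ?_ fun ξ hξ => ?_
  · rwa [IsHermitian, conjTranspose_eq_transpose_of_trivial]
  · rw [star_trivial]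
    have hξ_pos : 0 < ξ ⬝ᵥ ξ := by
      simpa only [star_trivial] using dotProduct_star_self_pos_iff.2 hξ
    exact (mul_pos hcoeff hξ_pos).trans_le (hquad ξ)
end
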